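/- Let w ∈ ℂ^N, let J be an n×N complex matrix, set F = J H(w) J^*, and let Φ, Ψ be n×n complex matrices. Then for every x ∈ ℂ^n one has the lower bound x^*(Φ F Φ^* − Ψ Fᵀ Ψ^*) x ≥ ‖J^* Φ^* x‖² − (1+‖w‖²)‖Jᵀ Ψ^* x‖² (both sides being real numbers). -/

import Mathlib

open Matrix ComplexOrder

/-- The squared Euclidean norm `‖v‖²` of a vector `v ∈ ℂ^k`. -/
noncomputable def sqNorm {k : ℕ} (v : Fin k → ℂ) : ℝ := ∑ i, ‖v i‖ ^ 2

/-- The matrix `H(w) = (1 + ‖w‖²) I_N − w̄ wᵀ`, with `(l,m)` entry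
`(1+‖w‖²)δ_{lm} − w̄_l w_m`. -/
noncomputable def Hmat {N : ℕ} (w : Fin N → ℂ) : Matrix (Fin N) (Fin N) ℂ :=
  ((1 + sqNorm w : ℝ) : ℂ) • (1 : Matrix (Fin N) (Fin N) ℂ) -
    Matrix.vecMulVec (star w) w

theorem star_dotProduct_self_eq_sqNorm {k : ℕ} (v : Fin k → ℂ) :
    star v ⬝ᵥ v = (sqNorm v : ℂ) := by
  simp [dotProduct, sqNorm, Complex.conj_mul']

theorem sqNorm_star {k : ℕ} (v : Fin k → ℂ) : sqNorm (star v) = sqNorm v := by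
  simp [sqNorm]

theorem norm_dotProduct_sq_le {k : ℕ} (v u : Fin k → ℂ) :
    ‖v ⬝ᵥ u‖ ^ 2 ≤ sqNorm v * sqNorm u := by
  have h : ‖v ⬝ᵥ u‖ ≤ ∑ i, ‖v i‖ * ‖u i‖ := by
    simpa only [dotProduct, norm_mul] using norm_sum_le Finset.univ fun i => v i * u i
  calc ‖v ⬝ᵥ u‖ ^ 2 ≤ (∑ i, ‖v i‖ * ‖u i‖) ^ 2 := by gcongr
    _ ≤ sqNorm v * sqNorm u := Finset.sum_mul_sq_le_sq_mul_sq _ _ _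

theorem transpose_Hmat {N : ℕ} (w : Fin N → ℂ) : (Hmat w)ᵀ = Hmat (star w) := by
  simp [Hmat, sqNorm_star, transpose_vecMulVec]

theorem star_dotProduct_Hmat_mulVec {N : ℕ} (w u : Fin N → ℂ) :
    star u ⬝ᵥ Hmat w *ᵥ u
      = (((1 + sqNorm w) * sqNorm u - ‖w ⬝ᵥ u‖ ^ 2 : ℝ) : ℂ) := by
  have h : star u ⬝ᵥ star w = star (w ⬝ᵥ u) := (star_dotProduct_star u w).trans (by
    rw [dotProduct_comm])
  rw [Hmat, sub_mulVec, smul_mulVec, one_mulVec, vecMulVec_mulVec, dotProduct_sub,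
    dotProduct_smul, dotProduct_smul, star_dotProduct_self_eq_sqNorm, h]
  simp [Complex.conj_mul']

theorem star_dotProduct_mul_mul_conjTranspose_mulVec {m k : ℕ} (A : Matrix (Fin m) (Fin k) ℂ)
    (M : Matrix (Fin k) (Fin k) ℂ) (x : Fin m → ℂ) :
    star x ⬝ᵥ (A * M * Aᴴ) *ᵥ x = star (Aᴴ *ᵥ x) ⬝ᵥ M *ᵥ (Aᴴ *ᵥ x) := by
  rw [star_mulVec, conjTranspose_conjTranspose, ← dotProduct_mulVec]
  simp only [mulVec_mulVec, Matrix.mul_assoc]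

/-- Let `w ∈ ℂ^N`, let `J` be an `n×N` complex matrix, set `F = J H(w) J^*`,
and let `Φ, Ψ` be `n×n` complex matrices.  Then for every `x ∈ ℂ^n` one has
the lower bound
`x^*(Φ F Φ^* − Ψ Fᵀ Ψ^*) x ≥ ‖J^* Φ^* x‖² − (1+‖w‖²)‖Jᵀ Ψ^* x‖²`
(both sides being real, the inequality is taken in the complex order). -/
theorem stmt3 {N n : ℕ} (w : Fin N → ℂ) (J : Matrix (Fin n) (Fin N) ℂ)
    (Φ Ψ : Matrix (Fin n) (Fin n) ℂ) (F : Matrix (Fin n) (Fin n) ℂ)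
    (hF : F = J * Hmat w * Jᴴ) :
    ∀ x : Fin n → ℂ,
      ((sqNorm (Jᴴ.mulVec (Φᴴ.mulVec x))
          - (1 + sqNorm w) * sqNorm (Jᵀ.mulVec (Ψᴴ.mulVec x)) : ℝ) : ℂ)
        ≤ star x ⬝ᵥ (Φ * F * Φᴴ - Ψ * Fᵀ * Ψᴴ).mulVec x := by
  intro x
  have hFt : Fᵀ = Jᵀᴴ * Hmat (star w) * Jᵀᴴᴴ := by
    rw [hF, transpose_mul, transpose_mul, transpose_Hmat, conjTranspose_conjTranspose,
      Matrix.mul_assoc]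
    rfl
  rw [sub_mulVec, dotProduct_sub, star_dotProduct_mul_mul_conjTranspose_mulVec Φ,
    star_dotProduct_mul_mul_conjTranspose_mulVec Ψ, hFt, hF,
    star_dotProduct_mul_mul_conjTranspose_mulVec J,
    star_dotProduct_mul_mul_conjTranspose_mulVec Jᵀᴴ, conjTranspose_conjTranspose,
    star_dotProduct_Hmat_mulVec, star_dotProduct_Hmat_mulVec, sqNorm_star,
    ← Complex.ofReal_sub, Complex.real_le_real]
  linarith [norm_dotProduct_sq_le w (Jᴴ *ᵥ (Φᴴ *ᵥ x)),
    sq_nonneg ‖star w ⬝ᵥ Jᵀ *ᵥ (Ψᴴ *ᵥ x)‖]
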